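/- Let n, k, l be positive integers with k ≥ l and n ≥ k + l. If F_1 ⊆ C([n],k) and F_2 ⊆ C([n],l) are non-empty cross-intersecting families, then |F_1| + |F_2| ≤ C(n,k) - C(n-l,k) + 1. -/

import Mathlib

open Finset

/-- Binomial coefficients increase from `a` to `b` whenever `a ≤ b ≤ N - a`. -/
lemma choose_le_choose_of_add_le {N a b : ℕ} (hab : a ≤ b) (h : a + b ≤ N) :
    N.choose a ≤ N.choose b := by
  have h1 := Nat.choose_mul (n := N) (k := b) (s := a) hab
  have h2 : b.choose a ≤ (N - a).choose (b - a) := by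
    rw [← Nat.choose_symm hab]
    exact Nat.choose_le_choose _ (by omega)
  have h3 : 0 < b.choose a := Nat.choose_pos hab
  refine Nat.le_of_mul_le_mul_right ?_ h3
  rw [h1]
  exact Nat.mul_le_mul_left _ h2

lemma choose_add_choose_sub_le {N a b : ℕ} (hab : a ≤ b) (h : a + b ≤ N) :
    N.choose a + (N - a).choose b ≤ N.choose b + (N - b).choose a := by
  have hxy : N.choose a * (N - a).choose b = N.choose b * (N - b).choose a := by
    have h1 := Nat.choose_mul (n := N) (k := a + b) (s := a) (by omega)
    have h2 := Nat.choose_mul (n := N) (k := a + b) (s := b) (by omega)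
    rw [show a + b - a = b by omega] at h1
    rw [show a + b - b = a by omega] at h2
    rw [← h1, ← h2, Nat.choose_symm_add]
  have hx : N.choose a ≤ N.choose b := choose_le_choose_of_add_le hab h
  have hy : (N - a).choose b ≤ N.choose b := Nat.choose_le_choose _ (by omega)
  have hpos : 0 < N.choose b := Nat.choose_pos (by omega)
  refine Nat.le_of_mul_le_mul_left ?_ hpos
  obtain ⟨c, hc⟩ := Nat.exists_eq_add_of_le hx
  nlinarith [Nat.mul_le_mul_left c hy]

/-- The number of `l`-subsets of an `N`-set meeting a fixed `(k + 1)`-subset is at most the number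
of `k`-subsets meeting a fixed `(l + 1)`-subset. -/
lemma choose_add_choose_sub_succ_le {N k l : ℕ} (hkl : l ≤ k) (h : k + l + 2 ≤ N) :
    N.choose l + (N - (l + 1)).choose k ≤ N.choose k + (N - (k + 1)).choose l := by
  have h1 := choose_add_choose_sub_le (N := N) hkl (by omega)
  obtain ⟨M, rfl⟩ : ∃ M, N = k + l + 2 + M := ⟨N - (k + l + 2), by omega⟩
  rw [show k + l + 2 + M - l = k + M + 1 + 1 by omega,
    show k + l + 2 + M - k = l + M + 1 + 1 by omega] at h1
  rw [show k + l + 2 + M - (l + 1) = k + M + 1 by omega,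
    show k + l + 2 + M - (k + 1) = l + M + 1 by omega]
  rcases l with _ | l
  · simp only [Nat.choose_zero_right] at h1 ⊢
    have := Nat.choose_le_choose k (show k + M + 1 ≤ k + M + 1 + 1 by omega)
    omega
  · obtain ⟨k, rfl⟩ : ∃ j, k = j + 1 := ⟨k - 1, by omega⟩
    rw [Nat.choose_succ_succ (k + 1 + M + 1) k, Nat.choose_succ_succ (l + 1 + M + 1) l] at h1
    have h2 : (l + 1 + M + 1).choose l ≤ (k + 1 + M + 1).choose k := by
      rw [← Nat.choose_symm_of_eq_add (show l + 1 + M + 1 = (M + 2) + l by omega),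
        ← Nat.choose_symm_of_eq_add (show k + 1 + M + 1 = (M + 2) + k by omega)]
      exact Nat.choose_le_choose _ (by omega)
    simp only [Nat.succ_eq_add_one] at h1
    omega

section Families

variable {α : Type*} [DecidableEq α]

def CrossIntersecting (F G : Finset (Finset α)) : Prop :=
  ∀ A ∈ F, ∀ B ∈ G, (A ∩ B).Nonempty

lemma CrossIntersecting.symm {F G : Finset (Finset α)} (h : CrossIntersecting F G) :
    CrossIntersecting G F := fun A hA B hB => by
  rw [inter_comm]
  exact h B hB A hA

/-- Every member of `F` containing `z` but not `x` stays in `F` when `z` is replaced by `x`. -/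
def ShiftStable (S : Finset α) (z : α) (F : Finset (Finset α)) : Prop :=
  ∀ x ∈ S, x ≠ z → ∀ A ∈ F, z ∈ A → x ∉ A → insert x (A.erase z) ∈ F

lemma compress_singleton {x z : α} (hxz : x ≠ z) (A : Finset α) :
    UV.compress {x} {z} A = if x ∉ A ∧ z ∈ A then insert x (A.erase z) else A := by
  unfold UV.compress
  simp only [disjoint_singleton_left, singleton_subset_iff, sup_eq_union]
  split_ifs
  · ext y
    simp only [mem_sdiff, mem_union, mem_singleton, mem_insert, mem_erase]
    grind
  · rfl

lemma mem_compression_singleton {x z : α} (hxz : x ≠ z) {F : Finset (Finset α)} {A : Finset α}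
    (hA : A ∈ UV.compression {x} {z} F) :
    (A ∈ F ∧ (x ∉ A → z ∈ A → insert x (A.erase z) ∈ F)) ∨
      (A ∉ F ∧ ∃ B ∈ F, x ∉ B ∧ z ∈ B ∧ A = insert x (B.erase z)) := by
  rw [UV.mem_compression] at hA
  rcases hA with ⟨h1, h2⟩ | ⟨h1, B, hB, h2⟩
  · left
    refine ⟨h1, fun hx hz => ?_⟩
    rwa [compress_singleton hxz, if_pos ⟨hx, hz⟩] at h2
  · right
    rw [compress_singleton hxz] at h2
    split_ifs at h2 with h
    · exact ⟨h1, B, hB, h.1, h.2, h2.symm⟩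
    · exact absurd (h2 ▸ hB) h1

lemma CrossIntersecting.compression {x z : α} (hxz : x ≠ z) {F G : Finset (Finset α)}
    (h : CrossIntersecting F G) :
    CrossIntersecting (UV.compression {x} {z} F) (UV.compression {x} {z} G) := by
  have mixed : ∀ {F G : Finset (Finset α)}, CrossIntersecting F G → ∀ A ∈ F,
      (x ∉ A → z ∈ A → insert x (A.erase z) ∈ F) → ∀ B ∈ G, x ∉ B → z ∈ B →
        (A ∩ insert x (B.erase z)).Nonempty := by
    intro F G h A hA hA' B hB hxB hzB
    obtain ⟨y, hy⟩ := h A hA B hB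
    rw [mem_inter] at hy
    by_cases hxA : x ∈ A
    · exact ⟨x, by simp [hxA]⟩
    by_cases hzA : z ∈ A
    · obtain ⟨w, hw⟩ := h _ (hA' hxA hzA) B hB
      simp only [mem_inter, mem_insert, mem_erase] at hw
      refine ⟨w, ?_⟩
      simp only [mem_inter, mem_insert, mem_erase]
      grind
    · refine ⟨y, ?_⟩
      simp only [mem_inter, mem_insert, mem_erase]
      grind
  intro A hA B hB
  rcases mem_compression_singleton hxz hA with ⟨hA1, hA2⟩ | ⟨-, A', hA', hxA, hzA, rfl⟩ <;>
  rcases mem_compression_singleton hxz hB with ⟨hB1, hB2⟩ | ⟨-, B', hB', hxB, hzB, rfl⟩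
  · exact h A hA1 B hB1
  · exact mixed h A hA1 hA2 B' hB' hxB hzB
  · rw [inter_comm]
    exact mixed h.symm B hB1 hB2 A' hA' hxA hzA
  · exact ⟨x, by simp⟩

lemma compression_subset_powersetCard {S : Finset α} {x z : α} (hx : x ∈ S) (hxz : x ≠ z) {k : ℕ}
    {F : Finset (Finset α)} (hF : F ⊆ S.powersetCard k) :
    UV.compression {x} {z} F ⊆ S.powersetCard k := by
  intro A hA
  rcases mem_compression_singleton hxz hA with ⟨h, -⟩ | ⟨-, B, hB, hxB, hzB, rfl⟩
  · exact hF h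
  · obtain ⟨hBS, hBk⟩ := mem_powersetCard.1 (hF hB)
    refine mem_powersetCard.2 ⟨insert_subset hx ((erase_subset _ _).trans hBS), ?_⟩
    rw [card_insert_of_notMem (by simp [hxB]), card_erase_add_one hzB, hBk]

lemma filter_mem_compression_subset {x z : α} (hxz : x ≠ z) (F : Finset (Finset α)) :
    {A ∈ UV.compression {x} {z} F | z ∈ A} ⊆ {A ∈ F | z ∈ A} := by
  intro A hA
  rw [mem_filter] at hA ⊢
  rcases mem_compression_singleton hxz hA.1 with ⟨h, -⟩ | ⟨-, B, hB, hxB, hzB, rfl⟩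
  · exact ⟨h, hA.2⟩
  · simp [hxz.symm] at hA

lemma card_filter_mem_compression_lt {x z : α} (hxz : x ≠ z) {F : Finset (Finset α)}
    {A : Finset α} (hA : A ∈ F) (hz : z ∈ A) (hx : x ∉ A) (hA' : insert x (A.erase z) ∉ F) :
    #{A ∈ UV.compression {x} {z} F | z ∈ A} < #{A ∈ F | z ∈ A} := by
  refine card_lt_card ((ssubset_iff_of_subset (filter_mem_compression_subset hxz F)).2
    ⟨A, mem_filter.2 ⟨hA, hz⟩, fun h => ?_⟩)
  rcases mem_compression_singleton hxz (mem_filter.1 h).1 with ⟨-, h⟩ | ⟨h, -⟩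
  · exact hA' (h hx hz)
  · exact h hA

lemma CrossIntersecting.exists_shiftStable {S : Finset α} (z : α) {k l : ℕ}
    {F G : Finset (Finset α)} (h : CrossIntersecting F G) (hF : F ⊆ S.powersetCard k)
    (hG : G ⊆ S.powersetCard l) :
    ∃ F' G' : Finset (Finset α), #F' = #F ∧ #G' = #G ∧ CrossIntersecting F' G' ∧
      F' ⊆ S.powersetCard k ∧ G' ⊆ S.powersetCard l ∧ ShiftStable S z F' ∧ ShiftStable S z G' := by
  induction hm : #{A ∈ F | z ∈ A} + #{A ∈ G | z ∈ A} using Nat.strong_induction_on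
    generalizing F G with
  | _ m ih =>
  by_cases hst : ShiftStable S z F ∧ ShiftStable S z G
  · exact ⟨F, G, rfl, rfl, h, hF, hG, hst⟩
  obtain ⟨x, hx, hxz, hlt⟩ : ∃ x ∈ S, x ≠ z ∧ #{A ∈ UV.compression {x} {z} F | z ∈ A} +
      #{A ∈ UV.compression {x} {z} G | z ∈ A} < m := by
    rw [not_and_or] at hst
    unfold ShiftStable at hst
    push Not at hst
    rcases hst with ⟨x, hx, hxz, A, hA, hz, hxA, hA'⟩ | ⟨x, hx, hxz, A, hA, hz, hxA, hA'⟩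
    · have h1 := card_filter_mem_compression_lt hxz hA hz hxA hA'
      have h2 := card_le_card (filter_mem_compression_subset hxz G)
      exact ⟨x, hx, hxz, by omega⟩
    · have h1 := card_filter_mem_compression_lt hxz hA hz hxA hA'
      have h2 := card_le_card (filter_mem_compression_subset hxz F)
      exact ⟨x, hx, hxz, by omega⟩
  obtain ⟨F', G', h1, h2, h3⟩ := ih _ hlt (h.compression hxz)
    (compression_subset_powersetCard hx hxz hF) (compression_subset_powersetCard hx hxz hG) rfl
  exact ⟨F', G', by rw [h1, UV.card_compression], by rw [h2, UV.card_compression], h3⟩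

lemma card_add_choose_le_of_forall_inter_nonempty {S T : Finset α} {k : ℕ}
    {F : Finset (Finset α)} (hF : F ⊆ S.powersetCard k) (hT : T ⊆ S)
    (h : ∀ A ∈ F, (A ∩ T).Nonempty) :
    #F + (#S - #T).choose k ≤ (#S).choose k := by
  rw [← card_sdiff_of_subset hT, ← card_powersetCard, ← card_powersetCard k S,
    ← card_union_of_disjoint]
  · exact card_le_card (union_subset hF (powersetCard_mono sdiff_subset))
  · rw [disjoint_left]
    intro A hA hA'
    obtain ⟨y, hy⟩ := h A hA
    rw [mem_inter] at hy
    exact (mem_sdiff.1 ((mem_powersetCard.1 hA').1 hy.1)).2 hy.2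

lemma CrossIntersecting.card_add_card_le_of_card_eq {S : Finset α} {k l : ℕ}
    {F G : Finset (Finset α)} (h : CrossIntersecting F G) (hS : #S = k + l)
    (hF : F ⊆ S.powersetCard k) (hG : G ⊆ S.powersetCard l) :
    #F + #G ≤ (#S).choose k := by
  have hinj : Set.InjOn (fun B => S \ B) (G : Set (Finset α)) := by
    intro A hA B hB hAB
    have hA' := (mem_powersetCard.1 (hG hA)).1
    have hB' := (mem_powersetCard.1 (hG hB)).1
    simpa [hA', hB'] using congrArg (S \ ·) hAB
  rw [← card_image_of_injOn hinj, ← card_powersetCard k S, ← card_union_of_disjoint]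
  · refine card_le_card (union_subset hF (image_subset_iff.2 fun B hB => ?_))
    obtain ⟨hBS, hBl⟩ := mem_powersetCard.1 (hG hB)
    rw [mem_powersetCard, card_sdiff_of_subset hBS]
    exact ⟨sdiff_subset, by omega⟩
  · rw [disjoint_left]
    intro A hA hA'
    obtain ⟨B, hB, rfl⟩ := mem_image.1 hA'
    obtain ⟨y, hy⟩ := h _ hA B hB
    simp at hy

lemma memberSubfamily_subset_powersetCard {S : Finset α} {z : α} {k : ℕ}
    {F : Finset (Finset α)} (hF : F ⊆ S.powersetCard k) :
    F.memberSubfamily z ⊆ (S.erase z).powersetCard (k - 1) := by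
  intro A hA
  obtain ⟨h1, h2⟩ := mem_memberSubfamily.1 hA
  obtain ⟨h3, h4⟩ := mem_powersetCard.1 (hF h1)
  rw [card_insert_of_notMem h2] at h4
  exact mem_powersetCard.2
    ⟨subset_erase.2 ⟨(subset_insert _ _).trans h3, h2⟩, by omega⟩

lemma nonMemberSubfamily_subset_powersetCard {S : Finset α} {z : α} {k : ℕ}
    {F : Finset (Finset α)} (hF : F ⊆ S.powersetCard k) :
    F.nonMemberSubfamily z ⊆ (S.erase z).powersetCard k := by
  intro A hA
  obtain ⟨h1, h2⟩ := mem_nonMemberSubfamily.1 hA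
  obtain ⟨h3, h4⟩ := mem_powersetCard.1 (hF h1)
  exact mem_powersetCard.2 ⟨subset_erase.2 ⟨h3, h2⟩, h4⟩

lemma ShiftStable.nonMemberSubfamily_nonempty {S : Finset α} {z : α} {k : ℕ}
    {F : Finset (Finset α)} (hst : ShiftStable S z F) (hF : F ⊆ S.powersetCard k)
    (hk : k < #S) (hne : F.Nonempty) : (F.nonMemberSubfamily z).Nonempty := by
  obtain ⟨A, hA⟩ := hne
  by_cases hz : z ∈ A
  · obtain ⟨hAS, hAk⟩ := mem_powersetCard.1 (hF hA)
    obtain ⟨x, hx, hxA⟩ := exists_mem_notMem_of_card_lt_card (hAk.trans_lt hk)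
    have hxz : x ≠ z := by
      rintro rfl
      exact hxA hz
    exact ⟨_, mem_nonMemberSubfamily.2 ⟨hst x hx hxz A hA hz hxA, by simp [hxz.symm]⟩⟩
  · exact ⟨A, mem_nonMemberSubfamily.2 ⟨hA, hz⟩⟩

lemma CrossIntersecting.memberSubfamily {S : Finset α} {z : α} {k l : ℕ}
    {F G : Finset (Finset α)} (h : CrossIntersecting F G) (hst : ShiftStable S z F)
    (hF : F ⊆ S.powersetCard k) (hG : G ⊆ S.powersetCard l) (hS : k + l ≤ #S) :
    CrossIntersecting (F.memberSubfamily z) (G.memberSubfamily z) := by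
  intro A hA B hB
  obtain ⟨hA1, hA2⟩ := mem_memberSubfamily.1 hA
  obtain ⟨hB1, hB2⟩ := mem_memberSubfamily.1 hB
  have hAk := (mem_powersetCard.1 (hF hA1)).2
  have hBl := (mem_powersetCard.1 (hG hB1)).2
  rw [card_insert_of_notMem hA2] at hAk
  rw [card_insert_of_notMem hB2] at hBl
  have hlt : #(insert z (A ∪ B)) < #S := by
    have h1 := card_insert_le z (A ∪ B)
    have h2 := card_union_le A B
    omega
  obtain ⟨x, hx, hx'⟩ := exists_mem_notMem_of_card_lt_card hlt
  simp only [mem_insert, mem_union, not_or] at hx'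
  obtain ⟨hxz, hxA, hxB⟩ := hx'
  have hA' := hst x hx hxz _ hA1 (mem_insert_self _ _) (by simp [hxz, hxA])
  rw [erase_insert hA2] at hA'
  obtain ⟨y, hy⟩ := h _ hA' _ hB1
  refine ⟨y, ?_⟩
  simp only [mem_inter, mem_insert] at hy ⊢
  grind

lemma CrossIntersecting.nonMemberSubfamily {z : α} {F G : Finset (Finset α)}
    (h : CrossIntersecting F G) :
    CrossIntersecting (F.nonMemberSubfamily z) (G.nonMemberSubfamily z) :=
  fun A hA B hB => h A (mem_nonMemberSubfamily.1 hA).1 B (mem_nonMemberSubfamily.1 hB).1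

lemma CrossIntersecting.card_memberSubfamily_add_choose_le {S : Finset α} {z : α} {k l : ℕ}
    {F G : Finset (Finset α)} (h : CrossIntersecting F G) (hF : F ⊆ S.powersetCard k)
    (hG : G ⊆ S.powersetCard l) (hne : (G.nonMemberSubfamily z).Nonempty) :
    #(F.memberSubfamily z) + (#(S.erase z) - l).choose (k - 1) ≤
      (#(S.erase z)).choose (k - 1) := by
  obtain ⟨B, hB⟩ := hne
  obtain ⟨hBS, hBl⟩ := mem_powersetCard.1 (nonMemberSubfamily_subset_powersetCard hG hB)
  rw [← hBl]
  refine card_add_choose_le_of_forall_inter_nonempty (memberSubfamily_subset_powersetCard hF) hBS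
    fun A hA => ?_
  obtain ⟨y, hy⟩ := h _ (mem_memberSubfamily.1 hA).1 B (mem_nonMemberSubfamily.1 hB).1
  have hzB := (mem_nonMemberSubfamily.1 hB).2
  refine ⟨y, ?_⟩
  simp only [mem_inter, mem_insert] at hy ⊢
  grind

/-- The **Frankl–Tokushige bound** for non-empty cross-intersecting families. -/
theorem CrossIntersecting.card_add_card_add_choose_le {S : Finset α} {k l : ℕ}
    {F G : Finset (Finset α)} (h : CrossIntersecting F G) (hl : 0 < l) (hkl : l ≤ k)
    (hS : k + l ≤ #S) (hF : F ⊆ S.powersetCard k) (hG : G ⊆ S.powersetCard l)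
    (hFne : F.Nonempty) (hGne : G.Nonempty) :
    #F + #G + (#S - l).choose k ≤ (#S).choose k + 1 := by
  induction hn : #S generalizing S k l F G with
  | zero => omega
  | succ N ih =>
  rcases hS.eq_or_lt with heq | hlt
  · have := h.card_add_card_le_of_card_eq heq.symm hF hG
    rw [show N + 1 - l = k by omega, Nat.choose_self, ← hn]
    omega
  obtain ⟨z, hz⟩ : S.Nonempty := card_pos.1 (by omega)
  obtain ⟨F', G', hF'c, hG'c, h', hF', hG', hstF, hstG⟩ := h.exists_shiftStable z hF hG
  rw [← hF'c, ← hG'c]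
  replace hFne : F'.Nonempty := card_pos.1 (hF'c ▸ card_pos.2 hFne)
  replace hGne : G'.Nonempty := card_pos.1 (hG'c ▸ card_pos.2 hGne)
  clear h hF hG hF'c hG'c F G
  have hN : #(S.erase z) = N := by rw [card_erase_of_mem hz, hn, Nat.add_sub_cancel]
  have hF0 := hstF.nonMemberSubfamily_nonempty hF' (by omega) hFne
  have hG0 := hstG.nonMemberSubfamily_nonempty hG' (by omega) hGne
  have hFsum := card_memberSubfamily_add_card_nonMemberSubfamily z F'
  have hGsum := card_memberSubfamily_add_card_nonMemberSubfamily z G'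
  have key := ih (h'.nonMemberSubfamily (z := z)) hl hkl (by omega)
    (nonMemberSubfamily_subset_powersetCard hF') (nonMemberSubfamily_subset_powersetCard hG')
    hF0 hG0 hN
  have hFm := h'.card_memberSubfamily_add_choose_le hF' hG' hG0
  have hGm := h'.symm.card_memberSubfamily_add_choose_le hG' hF' hF0
  rw [hN] at hFm hGm
  obtain ⟨k, rfl⟩ : ∃ j, k = j + 1 := ⟨k - 1, by omega⟩
  obtain ⟨l, rfl⟩ : ∃ j, l = j + 1 := ⟨l - 1, by omega⟩
  simp only [Nat.add_sub_cancel] at hFm hGm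
  have hp1 : (N + 1).choose (k + 1) = N.choose k + N.choose (k + 1) := Nat.choose_succ_succ _ _
  have hp2 : (N + 1 - (l + 1)).choose (k + 1) =
      (N - (l + 1)).choose k + (N - (l + 1)).choose (k + 1) := by
    rw [show N + 1 - (l + 1) = (N - (l + 1)) + 1 by omega]
    exact Nat.choose_succ_succ _ _
  rw [hp1, hp2]
  rcases (G'.memberSubfamily z).eq_empty_or_nonempty with hG1 | hG1
  · rw [hG1, card_empty] at hGsum
    omega
  rcases (F'.memberSubfamily z).eq_empty_or_nonempty with hF1 | hF1
  · rw [hF1, card_empty] at hFsum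
    have := choose_add_choose_sub_succ_le (N := N) (show l ≤ k by omega) (by omega)
    omega
  have hcross := h'.memberSubfamily hstF hF' hG' hS
  have hFsub := memberSubfamily_subset_powersetCard (z := z) hF'
  have hGsub := memberSubfamily_subset_powersetCard (z := z) hG'
  have hl' : 0 < l := by
    obtain ⟨A, hA⟩ := hF1
    obtain ⟨B, hB⟩ := hG1
    have h1 := card_pos.2 (hcross A hA B hB)
    have h2 := card_le_card (inter_subset_right (s₁ := A) (s₂ := B))
    have h3 := (mem_powersetCard.1 (hGsub hB)).2
    omega
  have key' := ih hcross hl' (by omega) (by omega) hFsub hGsub hF1 hG1 hN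
  simp only [Nat.add_sub_cancel] at key'
  obtain ⟨k, rfl⟩ : ∃ j, k = j + 1 := ⟨k - 1, by omega⟩
  have hp3 : (N - l).choose (k + 1) =
      (N - (l + 1)).choose k + (N - (l + 1)).choose (k + 1) := by
    rw [show N - l = (N - (l + 1)) + 1 by omega]
    exact Nat.choose_succ_succ _ _
  have hpos : 0 < (N - (l + 1)).choose k := Nat.choose_pos (by omega)
  omega

end Families

theorem stmt_10 (n k l : ℕ) (hl : 0 < l) (hkl : l ≤ k) (hn : k + l ≤ n)
    (F₁ F₂ : Finset (Finset ℕ))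
    (hF₁ : F₁ ⊆ (Finset.Icc 1 n).powersetCard k)
    (hF₂ : F₂ ⊆ (Finset.Icc 1 n).powersetCard l)
    (hne₁ : F₁.Nonempty) (hne₂ : F₂.Nonempty)
    (hcross : ∀ A ∈ F₁, ∀ B ∈ F₂, (A ∩ B).Nonempty) :
    F₁.card + F₂.card ≤ n.choose k - (n - l).choose k + 1 := by
  have hcard : #(Finset.Icc 1 n) = n := by simp
  have hbound := CrossIntersecting.card_add_card_add_choose_le (S := Finset.Icc 1 n) hcross hl hkl
    (by omega) hF₁ hF₂ hne₁ hne₂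
  rw [hcard] at hbound
  have := Nat.choose_le_choose k (Nat.sub_le n l)
  omega
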